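/- arXiv:2110.10203 — 2 statements merged into one kernel-verified Lean document; each statement's English description precedes it below -/
import Mathlib

section
/- Let G and H be countably infinite groups with Con*_c(G) = Con*_c(H). Then H admits a normal subgroup F such that G is isomorphic to the quotient group H/F. -/
/-- A countable partition of `X` indexed by `ℕ`: nonempty, pairwise disjoint parts
covering `X`. -/
def IsCountablePartition {X : Type*} (E : ℕ → Set X) : Prop :=
  (∀ i, (E i).Nonempty) ∧ (Pairwise fun i j => Disjoint (E i) (E j)) ∧ (⋃ i, E i) = Set.univ

/-- `Con_c(𝔤, ℰ)` for the action of `G` on itself by left multiplication: the set of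
countable-configurations corresponding to the countable-configuration pair `(g, E)`. -/
def countableConfigSet (G : Type*) [Group G] (g : ℕ → G) (E : ℕ → Set G) : Set (ℕ → ℕ) :=
  {C | ∃ x ∈ E (C 0), ∀ i, g i * x ∈ E (C (i + 1))}

/-- `Con*_c(G)`: the family of all countable-configuration sets `Con_c(𝔤, ℰ)` over
countable-configuration pairs `(𝔤, ℰ)` in which the entries of `𝔤` generate `G`. -/
def countableConfigStarFamily (G : Type*) [Group G] : Set (Set (ℕ → ℕ)) :=
  {S | ∃ (g : ℕ → G) (E : ℕ → Set G),
    Subgroup.closure (Set.range g) = ⊤ ∧ IsCountablePartition E ∧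
    S = countableConfigSet G g E}

/-- A map `φ : H → G` for which left translation by each member of a generating set of `H` is
intertwined with some left translation of `G` intertwines all left translations. -/
theorem exists_leftMul_intertwining {G H : Type*} [Group G] [Group H] (φ : H → G) (s : Set H)
    (hs : Subgroup.closure s = ⊤) (hφ : ∀ a ∈ s, ∃ b : G, ∀ y, φ (a * y) = b * φ y) (a : H) :
    ∃ b : G, ∀ y, φ (a * y) = b * φ y := by
  have ha : a ∈ Subgroup.closure s := hs ▸ Subgroup.mem_top a
  induction ha using Subgroup.closure_induction with
  | mem a ha => exact hφ a ha
  | one => exact ⟨1, fun y => by simp⟩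
  | mul a b _ _ iha ihb =>
    obtain ⟨c, hc⟩ := iha
    obtain ⟨d, hd⟩ := ihb
    exact ⟨c * d, fun y => by rw [mul_assoc, hc, hd, mul_assoc]⟩
  | inv a _ iha =>
    obtain ⟨c, hc⟩ := iha
    exact ⟨c⁻¹, fun y => by rw [eq_inv_mul_iff_mul_eq, ← hc, mul_inv_cancel_left]⟩

/-- A surjection that intertwines left translations yields a surjective homomorphism. -/
theorem exists_surjective_hom_of_leftMul_intertwining {G H : Type*} [Group G] [Group H]
    (φ : H → G) (hsurj : Function.Surjective φ)
    (hφ : ∀ a : H, ∃ b : G, ∀ y, φ (a * y) = b * φ y) :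
    ∃ ψ : H →* G, Function.Surjective ψ := by
  refine ⟨MonoidHom.mk' (fun a => φ a * (φ 1)⁻¹) fun a b => ?_, fun g => ?_⟩
  · obtain ⟨c, hc⟩ := hφ a
    have h1 := hc 1
    rw [mul_one] at h1
    rw [hc b, h1]
    group
  · obtain ⟨a, ha⟩ := hsurj (g * φ 1)
    exact ⟨a, by simp [ha]⟩

/-- The singletons of an enumeration form a countable partition. -/
theorem isCountablePartition_singleton {X : Type*} (e : ℕ ≃ X) :
    IsCountablePartition fun i => ({e i} : Set X) := by
  refine ⟨fun i => Set.singleton_nonempty _, fun i j hij => ?_, ?_⟩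
  · simpa using hij
  · exact Set.eq_univ_of_forall fun x => Set.mem_iUnion.2 ⟨e.symm x, by simp⟩

/-- If `G` and `H` are countably infinite groups with `Con*_c(G) = Con*_c(H)`, then `H` admits
a normal subgroup `F` with `G ≅ H ⧸ F`. -/
theorem quotient_iso_of_countableConfigStar_eq {G H : Type*} [Group G] [Group H]
    [Countable G] [Infinite G] [Countable H] [Infinite H]
    (h : countableConfigStarFamily G = countableConfigStarFamily H) :
    ∃ F : Subgroup H, ∃ hF : F.Normal, Nonempty (letI := hF; G ≃* H ⧸ F) := by
  obtain ⟨e⟩ : Nonempty (ℕ ≃ G) := nonempty_equiv_of_countable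
  have hmem : countableConfigSet G e (fun i => {e i}) ∈ countableConfigStarFamily H :=
    h ▸ ⟨e, _, by simp [e.surjective.range_eq], isCountablePartition_singleton e, rfl⟩
  obtain ⟨k, E, hk, ⟨hne, hdisj, hcover⟩, hset⟩ := hmem
  have hex : ∀ y : H, ∃ i, y ∈ E i := fun y => Set.mem_iUnion.1 (hcover ▸ Set.mem_univ y)
  choose c hc using hex
  have hconf : ∀ y i, e (c (k i * y)) = e i * e (c y) := by
    intro y i
    have hy : (fun n => Nat.casesOn n (c y) fun i => c (k i * y) : ℕ → ℕ) ∈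
        countableConfigSet H k E := ⟨y, hc y, fun i => hc (k i * y)⟩
    rw [← hset] at hy
    obtain ⟨x, hx, hxi⟩ := hy
    have hxi := hxi i
    simp only [Set.mem_singleton_iff] at hx hxi
    exact hxi.symm.trans (congrArg (e i * ·) hx)
  have hsurj : Function.Surjective fun y => e (c y) := by
    refine e.surjective.comp fun j => ?_
    obtain ⟨y, hy⟩ := hne j
    exact ⟨y, by_contra fun hj => (hdisj hj).le_bot ⟨hc y, hy⟩⟩
  obtain ⟨ψ, hψ⟩ := exists_surjective_hom_of_leftMul_intertwining _ hsurj
    (exists_leftMul_intertwining (fun y => e (c y)) (Set.range k) hk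
      (Set.forall_mem_range.2 fun i => ⟨e i, fun y => hconf y i⟩))
  exact ⟨ψ.ker, inferInstance, ⟨(QuotientGroup.quotientKerEquivOfSurjective ψ hψ).symm⟩⟩
end

section
/- Let G and H be countably infinite groups with Con*_c(G) = Con*_c(H). If moreover G is a Hopfian group (every surjective group homomorphism from G onto G is an isomorphism), then G is isomorphic to H. -/
/-- A group is Hopfian (a `Q`-group) if every surjective endomorphism is an isomorphism. -/
def IsHopfian (G : Type*) [Group G] : Prop :=
  ∀ f : G →* G, Function.Surjective f → Function.Bijective f

/-- If every countable-configuration set of generating sequences of a countably infinite group `G`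
also arises from `H`, then `G` is a quotient of `H`. -/
theorem exists_surjective_of_countableConfigStarFamily_subset {G H : Type*} [Group G] [Group H]
    [Countable G] [Infinite G]
    (h : countableConfigStarFamily G ⊆ countableConfigStarFamily H) :
    ∃ φ : H →* G, Function.Surjective φ := by
  obtain ⟨e⟩ : Nonempty (ℕ ≃ G) := nonempty_equiv_of_countable
  have hE : IsCountablePartition fun i => ({e i} : Set G) := by
    refine ⟨fun i => Set.singleton_nonempty _, fun i j hij => ?_, ?_⟩
    · simpa using hij
    · exact Set.eq_univ_of_forall fun x => Set.mem_iUnion.2 ⟨e.symm x, by simp⟩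
  obtain ⟨k, F, hk, ⟨hne, -, hcover⟩, hS⟩ :=
    h ⟨e, fun i => {e i}, by rw [e.surjective.range_eq]; exact Subgroup.closure_univ, hE, rfl⟩
  have hmem : ∀ y : H, ∃ n, y ∈ F n := fun y => by
    simpa using (hcover ▸ Set.mem_univ y : y ∈ ⋃ i, F i)
  choose c hc using hmem
  -- a configuration of `H` is a configuration of `G`, whose blocks are singletons
  have key : ∀ (y : H) (n : ℕ), y ∈ F n → ∀ i m, k i * y ∈ F m → e i * e n = e m := by
    intro y n hn i m hm
    have hC : (fun j : ℕ => Nat.casesOn j n fun l => if l = i then m else c (k l * y)) ∈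
        countableConfigSet H k F := by
      refine ⟨y, hn, fun l => ?_⟩
      by_cases hl : l = i
      · subst hl; simpa using hm
      · simpa [hl] using hc (k l * y)
    rw [← hS] at hC
    obtain ⟨x, hx, hx'⟩ := hC
    have h₁ := hx' i
    simp only [Set.mem_singleton_iff] at hx h₁
    simpa [hx] using h₁
  let p : H → G := fun y => e (c y)
  have hp : ∀ i y, p (k i * y) = e i * p y := fun i y =>
    (key y _ (hc y) i _ (hc _)).symm
  have hp_surj : Function.Surjective p := by
    intro x
    obtain ⟨i, hi⟩ := e.surjective 1
    obtain ⟨y, hy⟩ := hne (e.symm x)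
    refine ⟨k i * y, ?_⟩
    have := key y _ hy i _ (hc _)
    simpa [hi] using this.symm
  have hall : ∀ a : H, ∃ g : G, ∀ y, p (a * y) = g * p y := by
    intro a
    have ha : a ∈ Subgroup.closure (Set.range k) := hk ▸ Subgroup.mem_top a
    induction ha using Subgroup.closure_induction with
    | mem x hx =>
      obtain ⟨i, rfl⟩ := hx
      exact ⟨e i, hp i⟩
    | one => exact ⟨1, by simp⟩
    | mul a b _ _ iha ihb =>
      obtain ⟨g, hg⟩ := iha
      obtain ⟨g', hg'⟩ := ihb
      exact ⟨g * g', fun y => by rw [mul_assoc, hg, hg', mul_assoc]⟩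
    | inv a _ iha =>
      obtain ⟨g, hg⟩ := iha
      exact ⟨g⁻¹, fun y => by rw [eq_inv_mul_iff_mul_eq, ← hg, mul_inv_cancel_left]⟩
  choose f hf using hall
  refine ⟨MonoidHom.mk' f fun a b => ?_, fun x => ?_⟩
  · apply mul_right_cancel (b := p 1)
    rw [← hf, mul_assoc, hf, hf, mul_assoc]
  · obtain ⟨y, hy⟩ := hp_surj (x * p 1)
    refine ⟨y, mul_right_cancel (b := p 1) ?_⟩
    rw [MonoidHom.mk'_apply, ← hf, mul_one, hy]

/-- If `G` and `H` are countably infinite groups with `Con*_c(G) = Con*_c(H)` and `G` is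
Hopfian, then `G ≅ H`. -/
theorem iso_of_countableConfigStar_eq_of_hopfian {G H : Type*} [Group G] [Group H]
    [Countable G] [Infinite G] [Countable H] [Infinite H]
    (h : countableConfigStarFamily G = countableConfigStarFamily H)
    (hG : IsHopfian G) :
    Nonempty (G ≃* H) := by
  obtain ⟨φ, hφ⟩ := exists_surjective_of_countableConfigStarFamily_subset h.subset
  obtain ⟨ψ, hψ⟩ := exists_surjective_of_countableConfigStarFamily_subset h.symm.subset
  have hinj := (hG (φ.comp ψ) (hφ.comp hψ)).injective
  exact ⟨MulEquiv.ofBijective ψ ⟨.of_comp (f := φ) hinj, hψ⟩⟩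
end
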